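/- Under the data-dependence setup for the Karahan–Özdemir iterations of T and its ε-approximate operator T̃ (α_n^i ∈ [0,1], α_n¹ ≥ 1/2), the one-step estimate ‖p_{n+1} - p̃_{n+1}‖ ≤ [1 - α_n¹(1-δ)] ‖p_n - p̃_n‖ + α_n¹(1-δ) · 5ε/(1-δ) holds for all n. -/

import Mathlib

open Filter

theorem norm_combo_sub_combo_le {E : Type*} [SeminormedAddCommGroup E] [NormedSpace ℝ E]
    {a b c : ℝ} (ha : a ∈ Set.Icc (0 : ℝ) 1) {x y x' y' : E}
    (hx : ‖x - x'‖ ≤ b) (hy : ‖y - y'‖ ≤ c) :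
    ‖((1 - a) • x + a • y) - ((1 - a) • x' + a • y')‖ ≤ (1 - a) * b + a * c := by
  have h1 : 0 ≤ 1 - a := sub_nonneg.2 ha.2
  have h : ((1 - a) • x + a • y) - ((1 - a) • x' + a • y') =
      (1 - a) • (x - x') + a • (y - y') := by module
  rw [h]
  refine (norm_add_le _ _).trans ?_
  rw [norm_smul_of_nonneg h1, norm_smul_of_nonneg ha.1]
  exact add_le_add (mul_le_mul_of_nonneg_left hx h1) (mul_le_mul_of_nonneg_left hy ha.1)

theorem stmt_14 {B : Type*} [NormedAddCommGroup B] [NormedSpace ℝ B] [CompleteSpace B]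
    (S : Set B) (hS : S.Nonempty) (hScl : IsClosed S) (hSco : Convex ℝ S)
    (T T' : B → B) (hTS : ∀ x ∈ S, T x ∈ S) (hT'S : ∀ x ∈ S, T' x ∈ S)
    (δ : ℝ) (hδ : δ ∈ Set.Ioo (0 : ℝ) 1)
    (hT : ∀ x ∈ S, ∀ y ∈ S, ‖T x - T y‖ ≤ δ * ‖x - y‖)
    (ε : ℝ) (hε : 0 < ε) (happrox : ∀ x ∈ S, ‖T x - T' x‖ ≤ ε)
    (α1 α2 α3 : ℕ → ℝ)
    (hα1 : ∀ n, α1 n ∈ Set.Icc (0 : ℝ) 1) (hα2 : ∀ n, α2 n ∈ Set.Icc (0 : ℝ) 1)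
    (hα3 : ∀ n, α3 n ∈ Set.Icc (0 : ℝ) 1)
    (hhalf : ∀ n, (1 : ℝ) / 2 ≤ α1 n)
    (p q r p' q' r' : ℕ → B) (hp0 : p 0 ∈ S) (hp'0 : p' 0 ∈ S)
    (hp : ∀ n, p (n + 1) = (1 - α1 n) • T (p n) + α1 n • T (q n))
    (hq : ∀ n, q n = (1 - α2 n) • T (p n) + α2 n • T (r n))
    (hr : ∀ n, r n = (1 - α3 n) • p n + α3 n • T (p n))
    (hp' : ∀ n, p' (n + 1) = (1 - α1 n) • T' (p' n) + α1 n • T' (q' n))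
    (hq' : ∀ n, q' n = (1 - α2 n) • T' (p' n) + α2 n • T' (r' n))
    (hr' : ∀ n, r' n = (1 - α3 n) • p' n + α3 n • T' (p' n))
 :
    ∀ n, ‖p (n + 1) - p' (n + 1)‖ ≤
      (1 - α1 n * (1 - δ)) * ‖p n - p' n‖ + α1 n * (1 - δ) * (5 * ε / (1 - δ)) := by
  obtain ⟨hδ0, hδ1⟩ := hδ
  have combo {a : ℝ} (ha : a ∈ Set.Icc (0 : ℝ) 1) {x y : B} (hx : x ∈ S) (hy : y ∈ S) :
      (1 - a) • x + a • y ∈ S :=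
    hSco hx hy (sub_nonneg.2 ha.2) ha.1 (sub_add_cancel 1 a)
  have memS (U : B → B) (hU : ∀ x ∈ S, U x ∈ S) (u v w : ℕ → B) (hu0 : u 0 ∈ S)
      (hu : ∀ n, u (n + 1) = (1 - α1 n) • U (u n) + α1 n • U (v n))
      (hv : ∀ n, v n = (1 - α2 n) • U (u n) + α2 n • U (w n))
      (hw : ∀ n, w n = (1 - α3 n) • u n + α3 n • U (u n)) (n : ℕ) :
      u n ∈ S ∧ v n ∈ S ∧ w n ∈ S := by
    have hvw (n : ℕ) (h : u n ∈ S) : v n ∈ S ∧ w n ∈ S := by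
      have hwS : w n ∈ S := hw n ▸ combo (hα3 n) h (hU _ h)
      exact ⟨hv n ▸ combo (hα2 n) (hU _ h) (hU _ hwS), hwS⟩
    have huS : u n ∈ S := by
      induction n with
      | zero => exact hu0
      | succ n ih => exact hu n ▸ combo (hα1 n) (hU _ ih) (hU _ (hvw n ih).1)
    exact ⟨huS, hvw n huS⟩
  have key {x y : B} {d : ℝ} (hx : x ∈ S) (hy : y ∈ S) (hd : ‖x - y‖ ≤ d) :
      ‖T x - T' y‖ ≤ δ * d + ε :=
    (norm_sub_le_norm_sub_add_norm_sub _ (T y) _).trans <| add_le_add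
      ((hT x hx y hy).trans (mul_le_mul_of_nonneg_left hd hδ0.le)) (happrox y hy)
  intro n
  obtain ⟨hpS, hqS, hrS⟩ := memS T hTS p q r hp0 hp hq hr n
  obtain ⟨hpS', hqS', hrS'⟩ := memS T' hT'S p' q' r' hp'0 hp' hq' hr' n
  have hd := norm_nonneg (p n - p' n)
  have hTp := key hpS hpS' le_rfl
  have hpn := norm_combo_sub_combo_le (hα3 n) (le_refl ‖p n - p' n‖) hTp
  rw [← hr, ← hr'] at hpn
  obtain ⟨h10, h11⟩ := hα1 n
  obtain ⟨h20, h21⟩ := hα2 n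
  obtain ⟨h30, h31⟩ := hα3 n
  have hh := hhalf n
  set d := ‖p n - p' n‖
  have hδd : δ * d ≤ d := mul_le_of_le_one_left hd hδ1.le
  have hδε : δ * ε ≤ ε := mul_le_of_le_one_left hε.le hδ1.le
  have hrn : ‖r n - r' n‖ ≤ d + ε := by
    refine hpn.trans ?_
    have h1 := mul_le_mul_of_nonneg_left hδd h30
    have h2 := mul_le_of_le_one_left hε.le h31
    linarith
  have hqn := norm_combo_sub_combo_le (hα2 n) hTp (key hrS hrS' hrn)
  rw [← hq, ← hq'] at hqn
  have hqn' : ‖q n - q' n‖ ≤ d + 2 * ε := by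
    refine hqn.trans ?_
    have h1 := mul_le_mul_of_nonneg_left hδε h20
    have h2 := mul_le_of_le_one_left hε.le h21
    linarith
  have hpn1 := norm_combo_sub_combo_le (hα1 n) hTp (key hqS hqS' hqn')
  rw [← hp, ← hp'] at hpn1
  have hcancel : α1 n * (1 - δ) * (5 * ε / (1 - δ)) = α1 n * (5 * ε) := by
    have : 1 - δ ≠ 0 := (sub_pos.2 hδ1).ne'
    field_simp
  rw [hcancel]
  refine hpn1.trans ?_
  have h1 := mul_le_mul_of_nonneg_left hδd (sub_nonneg.2 h11)
  have h2 := mul_le_mul_of_nonneg_left hδε h10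
  have h3 := mul_le_mul_of_nonneg_right hh hε.le
  have h4 := mul_nonneg h10 hε.le
  linarith
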